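/- If x ≥ 0 and α ≤ 0, then the Wronskian matrix W := (d^{i-1}/dx^{i-1} A_{j-1}^{(q,α)}(x))_{1 ≤ i,j ≤ n+1} of the q-Abel basis at x is totally positive. -/

import Mathlib

open Finset Matrix

noncomputable def qInt (q : ℝ) (m : ℕ) : ℝ := ∑ i ∈ Finset.range m, q ^ i

noncomputable def qFact (q : ℝ) (m : ℕ) : ℝ := ∏ i ∈ Finset.range m, qInt q (i + 1)

noncomputable def qBinom (q : ℝ) (m k : ℕ) : ℝ :=
  if k ≤ m then qFact q m / (qFact q k * qFact q (m - k)) else 0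

noncomputable def qAbel (q α : ℝ) (m : ℕ) (x : ℝ) : ℝ :=
  if m = 0 then 1 else x * ∏ j ∈ Finset.Icc 1 (m - 1), (x * q ^ j - α * qInt q m)

def IsTotallyPos {n : ℕ} (A : Matrix (Fin n) (Fin n) ℝ) : Prop :=
  ∀ (k : ℕ) (f g : Fin k → Fin n), StrictMono f → StrictMono g →
    0 ≤ (A.submatrix f g).det

def IsStrictTotallyPos {n : ℕ} (A : Matrix (Fin n) (Fin n) ℝ) : Prop :=
  ∀ (k : ℕ) (f g : Fin k → Fin n), StrictMono f → StrictMono g →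
    0 < (A.submatrix f g).det

/-- All minors with rows below `N` are nonnegative. -/
def TPr (N : ℕ) (M : ℕ → ℕ → ℝ) : Prop :=
  ∀ (p : ℕ) (f g : Fin p → ℕ), StrictMono f → StrictMono g → (∀ i, f i < N) →
    0 ≤ (Matrix.of fun i j => M (f i) (g j)).det

/-- The direct sum of the one by one identity and `M`. -/
def extOne (M : ℕ → ℕ → ℝ) : ℕ → ℕ → ℝ
  | 0, 0 => 1
  | 0, _ + 1 => 0
  | _ + 1, 0 => 0
  | m + 1, k + 1 => M m k

theorem shift_exists {p : ℕ} (f : Fin p → ℕ) (hf : StrictMono f) (h : ∀ i, 0 < f i) :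
    ∃ f' : Fin p → ℕ, StrictMono f' ∧ ∀ i, f i = f' i + 1 := by
  refine ⟨fun i => f i - 1, ?_, ?_⟩
  · intro i j hij
    have := hf hij
    have := h i
    show f i - 1 < f j - 1
    omega
  · intro i
    have := h i
    show f i = f i - 1 + 1
    omega

theorem pos_of_zero_pos {p : ℕ} (f : Fin (p + 1) → ℕ) (hf : StrictMono f) (h : 0 < f 0) :
    ∀ i, 0 < f i := fun i => lt_of_lt_of_le h (hf.monotone (Fin.zero_le i))

theorem TPr_extOne {N : ℕ} {M : ℕ → ℕ → ℝ} (h : TPr N M) : TPr (N + 1) (extOne M) := by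
  intro p f g hf hg hN
  cases p with
  | zero => simp
  | succ p =>
    by_cases f0 : f 0 = 0
    · by_cases g0 : g 0 = 0
      · have hfs : ∀ i : Fin p, 0 < f i.succ := fun i => by
          have := hf (Fin.succ_pos i); omega
        have hgs : ∀ i : Fin p, 0 < g i.succ := fun i => by
          have := hg (Fin.succ_pos i); omega
        obtain ⟨f', hf', ef⟩ := shift_exists (f ∘ Fin.succ)
          (hf.comp (Fin.strictMono_succ)) hfs
        obtain ⟨g', hg', eg⟩ := shift_exists (g ∘ Fin.succ)
          (hg.comp (Fin.strictMono_succ)) hgs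
        rw [Matrix.det_succ_row_zero, Fin.sum_univ_succ]
        have z : ∀ j : Fin p, extOne M (f 0) (g j.succ) = 0 := by
          intro j
          have : g j.succ = g' j + 1 := eg j
          rw [f0, this]; rfl
        have o : extOne M (f 0) (g 0) = 1 := by rw [f0, g0]; rfl
        simp only [Matrix.of_apply, z, o, Fin.val_zero, pow_zero, mul_zero, zero_mul,
          Finset.sum_const_zero, add_zero, one_mul]
        have key := h p f' g' hf' hg' (fun i => by
          have := hN i.succ; have : f i.succ = f' i + 1 := ef i; omega)
        convert key using 2
        refine Matrix.ext fun i j => ?_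
        have e1 : f i.succ = f' i + 1 := ef i
        have e2 : g j.succ = g' j + 1 := eg j
        simp only [Matrix.submatrix_apply, Matrix.of_apply, Fin.succAbove_zero, e1, e2]
        rfl
      · apply le_of_eq
        symm
        apply Matrix.det_eq_zero_of_row_eq_zero 0
        intro j
        obtain ⟨g', hg', eg⟩ := shift_exists g hg (pos_of_zero_pos g hg (by omega))
        rw [Matrix.of_apply, f0, eg j]; rfl
    · obtain ⟨f', hf', ef⟩ := shift_exists f hf (pos_of_zero_pos f hf (by omega))
      by_cases g0 : g 0 = 0
      · apply le_of_eq
        symm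
        apply Matrix.det_eq_zero_of_column_eq_zero 0
        intro i
        rw [Matrix.of_apply, g0, ef i]; rfl
      · obtain ⟨g', hg', eg⟩ := shift_exists g hg (pos_of_zero_pos g hg (by omega))
        have key := h _ f' g' hf' hg' (fun i => by
          have := hN i; have := ef i; omega)
        convert key using 2
        refine Matrix.ext fun i j => ?_
        simp only [Matrix.of_apply, ef, eg]
        rfl

theorem TPr_bidiag {N : ℕ} {M : ℕ → ℕ → ℝ} (h : TPr N M) (c d : ℕ → ℝ) (hc : ∀ k, 0 ≤ c k)
    (hd : ∀ k, 0 ≤ d k) : TPr N (fun m k => c k * M m k + d k * M m (k + 1)) := by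
  intro p f g hf hg hN
  rw [← Matrix.det_transpose]
  have e : (Matrix.of fun i j => c (g j) * M (f i) (g j) + d (g j) * M (f i) (g j + 1))ᵀ
      = (fun j i => c (g j) * M (f i) (g j)) + (fun j i => d (g j) * M (f i) (g j + 1)) := by
    ext i j; rfl
  have e2 := (Matrix.detRowAlternating (n := Fin p) (R := ℝ)).toMultilinearMap.map_add_univ
    (fun j i => c (g j) * M (f i) (g j)) (fun j i => d (g j) * M (f i) (g j + 1))
  have e3 : (Matrix.of fun i j => c (g j) * M (f i) (g j) + d (g j) * M (f i) (g j + 1))ᵀ.det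
      = _ := (congrArg Matrix.det e).trans e2
  rw [e3]
  apply Finset.sum_nonneg
  intro s _
  set g' : Fin p → ℕ := fun j => if j ∈ s then g j else g j + 1 with hg'
  have e4 : (s.piecewise (fun j i => c (g j) * M (f i) (g j))
      (fun j i => d (g j) * M (f i) (g j + 1)) : Fin p → Fin p → ℝ)
      = Matrix.of (fun j i => (if j ∈ s then c (g j) else d (g j)) *
          (Matrix.of fun i j => M (f i) (g' j))ᵀ j i) := by
    ext j i
    by_cases hj : j ∈ s <;> simp [hj, hg', Finset.piecewise]
  have e5 : 0 ≤ Matrix.det (s.piecewise (fun j i => c (g j) * M (f i) (g j))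
      (fun j i => d (g j) * M (f i) (g j + 1)) : Fin p → Fin p → ℝ) := by
    rw [e4, Matrix.det_mul_column, Matrix.det_transpose]
    apply mul_nonneg
    · apply Finset.prod_nonneg
      intro j _
      split_ifs
      · exact hc _
      · exact hd _
    · by_cases hinj : Function.Injective g'
      · apply h p f g' hf _ hN
        have hmono : Monotone g' := by
          intro i j hij
          rcases hij.eq_or_lt with rfl | hlt
          · exact le_rfl
          · have := hg hlt
            simp only [hg']
            split_ifs <;> omega
        exact hmono.strictMono_of_injective hinj
      · simp only [Function.Injective] at hinj
        push Not at hinj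
        obtain ⟨i, j, hij, hne⟩ := hinj
        rw [Matrix.det_zero_of_column_eq hne]
        intro k
        simp [hij]
  exact e5

theorem TPr_of_scheme (S : Set (ℕ → ℕ → ℝ))
    (H : ∀ M ∈ S, ∃ M' ∈ S, ∃ c d : ℕ → ℝ, (∀ k, 0 ≤ c k) ∧ (∀ k, 0 ≤ d k) ∧
      ∀ m k, M m k = c k * extOne M' m k + d k * extOne M' m (k + 1)) (N : ℕ) :
    ∀ M ∈ S, TPr N M := by
  induction N with
  | zero =>
    intro M _ p f g _ _ hN
    cases p with
    | zero => simp
    | succ p => exact absurd (hN 0) (by omega)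
  | succ N ih =>
    intro M hM
    obtain ⟨M', hM', c, d, hc, hd, e⟩ := H M hM
    have := TPr_bidiag (TPr_extOne (ih M' hM')) c d hc hd
    have e' : M = fun m k => c k * extOne M' m k + d k * extOne M' m (k + 1) := by
      funext m k; exact e m k
    rw [e']; exact this

theorem TPr_pascal (x : ℝ) (hx : 0 ≤ x) (N : ℕ) :
    TPr N (fun m k => (m.choose k : ℝ) * x ^ (m - k)) := by
  refine TPr_of_scheme {fun m k => ((Nat.choose m k : ℕ) : ℝ) * x ^ (m - k)} ?_ N _ rfl
  rintro M rfl
  refine ⟨_, rfl, fun _ => 1, fun _ => x, fun _ => zero_le_one, fun _ => hx, ?_⟩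
  intro m k
  rcases m with _ | m <;> rcases k with _ | k
  · simp [extOne]
  · simp [extOne]
  · simp [extOne, pow_succ']
  · simp only [extOne, Nat.choose_succ_succ, Nat.succ_sub_succ]
    rcases lt_or_ge k m with hk | hk
    · have : m - k = (m - (k + 1)) + 1 := by omega
      rw [this, pow_succ]; push_cast; ring
    · rw [Nat.choose_eq_zero_of_lt (show m < k + 1 by omega)]; simp

/-- Weighted Newton matrix. -/
noncomputable def newtonMat (a : ℝ) (s : ℕ → ℝ) : ℕ → ℕ → ℝ :=
  fun m k => a ^ (m - k) * ∏ i ∈ Finset.range k, (s m - s i)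

theorem newton_prod_zero (s : ℕ → ℝ) {m k : ℕ} (h : m < k) :
    ∏ i ∈ Finset.range k, (s m - s i) = 0 :=
  Finset.prod_eq_zero (Finset.mem_range.2 h) (sub_self _)

theorem TPr_newton (a : ℝ) (ha : 0 ≤ a) (s : ℕ → ℝ) (hs : Monotone s) (N : ℕ) :
    TPr N (newtonMat a s) := by
  refine TPr_of_scheme {M | ∃ s : ℕ → ℝ, Monotone s ∧ M = newtonMat a s} ?_ N _ ⟨s, hs, rfl⟩
  rintro M ⟨s, hs, rfl⟩
  refine ⟨_, ⟨fun i => s (i + 1), fun i j h => hs (by omega), rfl⟩,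
    fun k => if k = 0 then 1 else s k - s 0, fun _ => a, ?_, fun _ => ha, ?_⟩
  · intro k
    show 0 ≤ if k = 0 then 1 else s k - s 0
    split_ifs
    · exact zero_le_one
    · exact sub_nonneg.2 (hs (Nat.zero_le k))
  · intro m k
    rcases m with _ | m <;> rcases k with _ | k
    · simp [extOne, newtonMat]
    · simp [extOne, newtonMat, Finset.prod_range_succ']
    · simp [extOne, newtonMat, pow_succ']
    · simp only [extOne, newtonMat, Nat.succ_sub_succ, Nat.succ_ne_zero, if_false]
      have z := fun k' => newton_prod_zero (fun i => s (i + 1)) (m := m) (k := k')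
      rw [Finset.prod_range_succ' (fun i => s (m + 1) - s i)]
      rcases lt_trichotomy m k with hk | rfl | hk
      · rw [z k hk, z (k + 1) (by omega)]; simp
      · rw [z (m + 1) (by omega)]; simp; ring
      · have : m - k = (m - (k + 1)) + 1 := by omega
        rw [this, pow_succ, Finset.prod_range_succ (fun i => s (m + 1) - s (i + 1))]; ring

theorem TPr_rowscale {N : ℕ} {M : ℕ → ℕ → ℝ} (h : TPr N M) (r : ℕ → ℝ) (hr : ∀ m, 0 ≤ r m) :
    TPr N (fun m k => r m * M m k) := by
  intro p f g hf hg hN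
  have := Matrix.det_mul_column (fun i => r (f i)) (Matrix.of fun i j => M (f i) (g j))
  simp only [Matrix.of_apply] at this
  rw [this]
  exact mul_nonneg (Finset.prod_nonneg fun i _ => hr _) (h p f g hf hg hN)

/-- The consequence of Cauchy-Binet that we need. -/
theorem det_mul_nonneg_of_minors {p N : ℕ} (A : Matrix (Fin p) (Fin N) ℝ)
    (B : Matrix (Fin N) (Fin p) ℝ)
    (hA : ∀ h : Fin p → Fin N, StrictMono h → 0 ≤ (A.submatrix id h).det)
    (hB : ∀ h : Fin p → Fin N, StrictMono h → 0 ≤ (B.submatrix h id).det) :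
    0 ≤ (A * B).det := by
  have h1 : (A * B).det = ∑ φ : Fin p → Fin N, (∏ j, B (φ j) j) * (A.submatrix id φ).det := by
    simp only [Matrix.det_apply', Matrix.mul_apply, Finset.prod_univ_sum, Finset.mul_sum,
      Fintype.piFinset_univ]
    rw [Finset.sum_comm]
    refine Finset.sum_congr rfl fun φ _ => Finset.sum_congr rfl fun σ _ => ?_
    simp only [Matrix.submatrix_apply, id, Finset.prod_mul_distrib]
    ring
  have h2 : ∀ σ : Equiv.Perm (Fin p), (A * B).det = ∑ φ : Fin p → Fin N,
      ((Equiv.Perm.sign σ : ℤ) : ℝ) * (∏ j, B (φ (σ j)) j) * (A.submatrix id φ).det := by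
    intro σ
    rw [h1, ← Equiv.sum_comp (Equiv.arrowCongr σ.symm (Equiv.refl (Fin N)))]
    refine Finset.sum_congr rfl fun φ _ => ?_
    have e1 : (Equiv.arrowCongr σ.symm (Equiv.refl (Fin N))) φ = φ ∘ σ := by
      ext j; simp [Equiv.arrowCongr]
    rw [e1]
    have := Matrix.det_permute' σ (A.submatrix id φ)
    rw [Matrix.submatrix_submatrix] at this
    simp only [Function.id_comp] at this
    rw [this]
    simp only [Function.comp]
    ring
  have h3 : (Fintype.card (Equiv.Perm (Fin p)) : ℝ) * (A * B).det =
      ∑ φ : Fin p → Fin N, (B.submatrix φ id).det * (A.submatrix id φ).det := by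
    calc (Fintype.card (Equiv.Perm (Fin p)) : ℝ) * (A * B).det
        = ∑ σ : Equiv.Perm (Fin p), (A * B).det := by simp
      _ = _ := by
        rw [Finset.sum_congr rfl fun σ _ => h2 σ, Finset.sum_comm]
        refine Finset.sum_congr rfl fun φ _ => ?_
        rw [← Finset.sum_mul, Matrix.det_apply' (B.submatrix φ id)]
        rfl
  have h4 : 0 ≤ (Fintype.card (Equiv.Perm (Fin p)) : ℝ) * (A * B).det := by
    rw [h3]
    apply Finset.sum_nonneg
    intro φ _
    by_cases hinj : Function.Injective φ
    · set σ := Tuple.sort φ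
      have hm : StrictMono (φ ∘ σ) :=
        (Tuple.monotone_sort φ).strictMono_of_injective (hinj.comp σ.injective)
      have a1 := hA _ hm
      have b1 := hB _ hm
      have a2 := Matrix.det_permute' σ (A.submatrix id φ)
      have b2 := Matrix.det_permute σ (B.submatrix φ id)
      rw [Matrix.submatrix_submatrix] at a2 b2
      simp only [Function.id_comp] at a2 b2
      rw [a2] at a1
      rw [b2] at b1
      have := mul_nonneg b1 a1
      rcases Int.units_eq_one_or (Equiv.Perm.sign σ) with hs | hs <;> rw [hs] at this <;>
        simpa using this
    · simp only [Function.Injective] at hinj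
      push Not at hinj
      obtain ⟨i, j, hij, hne⟩ := hinj
      rw [Matrix.det_zero_of_column_eq (M := A.submatrix id φ) hne, mul_zero]
      intro k
      simp [hij]
  have hc : (0 : ℝ) < Fintype.card (Equiv.Perm (Fin p)) := by
    exact_mod_cast Fintype.card_pos
  exact nonneg_of_mul_nonneg_right h4 hc

theorem qInt_pos {q : ℝ} (hq : 0 < q) (m : ℕ) : 0 < qInt q (m + 1) :=
  Finset.sum_pos (fun i _ => pow_pos hq i) ⟨0, by simp⟩

theorem qInt_add (q : ℝ) (m k : ℕ) : qInt q (m + k) = qInt q m + q ^ m * qInt q k := by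
  simp only [qInt, Finset.sum_range_add, Finset.mul_sum, pow_add]

theorem qInt_mono {q : ℝ} (hq : 0 < q) {m k : ℕ} (h : m ≤ k) : qInt q m ≤ qInt q k := by
  obtain ⟨d, rfl⟩ := Nat.exists_eq_add_of_le h
  rw [qInt_add]
  have : 0 ≤ qInt q d := Finset.sum_nonneg fun i _ => (pow_pos hq i).le
  have := mul_nonneg (pow_pos hq m).le this
  linarith

/-- Coefficients of the Rothe product. -/
noncomputable def rotheC (q : ℝ) (r k : ℕ) : ℝ :=
  ∏ i ∈ Finset.range k, ((qInt q (r + 1) - qInt q (i + 1)) / qInt q (i + 1))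

theorem rotheC_zero_of_lt (q : ℝ) {r k : ℕ} (h : r < k) : rotheC q r k = 0 :=
  Finset.prod_eq_zero (Finset.mem_range.2 h) (by simp)

theorem qInt_succ' (q : ℝ) (m : ℕ) : qInt q (m + 1) = 1 + q * qInt q m := by
  rw [add_comm m 1, qInt_add]; simp [qInt]

theorem rotheC_succ_aux {q : ℝ} (hq : 0 < q) (r k : ℕ) :
    rotheC q (r + 1) (k + 1) * qInt q (k + 1) = q ^ (k + 1) * qInt q (r + 1) * rotheC q r k := by
  induction k with
  | zero =>
    have h1 : qInt q 1 = 1 := by simp [qInt]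
    simp [rotheC, h1, qInt_succ' q (r + 1)]
  | succ k ih =>
    have p1 := (qInt_pos hq k).ne'
    have p2 := (qInt_pos hq (k + 1)).ne'
    have e1 : rotheC q (r + 1) (k + 1 + 1) * qInt q (k + 1 + 1) = rotheC q (r + 1) (k + 1) *
        (q * (qInt q (r + 1) - qInt q (k + 1))) := by
      rw [rotheC, Finset.prod_range_succ, ← rotheC, mul_assoc, div_mul_cancel₀ _ p2,
        qInt_succ' q (r + 1), qInt_succ' q (k + 1)]
      ring
    have e2 : rotheC q r (k + 1) * qInt q (k + 1) = rotheC q r k *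
        (qInt q (r + 1) - qInt q (k + 1)) := by
      rw [rotheC, Finset.prod_range_succ, ← rotheC, mul_assoc, div_mul_cancel₀ _ p1]
    apply mul_right_cancel₀ p1
    rw [e1]
    linear_combination (q * (qInt q (r + 1) - qInt q (k + 1))) * ih -
      q ^ (k + 2) * qInt q (r + 1) * e2

theorem rotheC_rec {q : ℝ} (hq : 0 < q) (r k : ℕ) :
    rotheC q (r + 1) (k + 1) = rotheC q r (k + 1) + q ^ (r + 1) * rotheC q r k := by
  have p1 := (qInt_pos hq k).ne'
  have e2 : rotheC q r (k + 1) * qInt q (k + 1) = rotheC q r k *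
      (qInt q (r + 1) - qInt q (k + 1)) := by
    rw [rotheC, Finset.prod_range_succ, ← rotheC, mul_assoc, div_mul_cancel₀ _ p1]
  have e3 := rotheC_succ_aux hq r k
  have a1 := qInt_add q (r + 1) (k + 1)
  have a2 := qInt_add q (k + 1) (r + 1)
  rw [add_comm (k + 1) (r + 1), a1] at a2
  apply mul_right_cancel₀ p1
  rw [e3, add_mul, e2]
  linear_combination (-rotheC q r k) * a2

theorem rothe {q : ℝ} (hq : 0 < q) (r : ℕ) (x y : ℝ) :
    ∏ j ∈ Finset.Icc 1 r, (x * q ^ j + y) =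
      ∑ k ∈ Finset.range (r + 1), rotheC q r k * x ^ k * y ^ (r - k) := by
  induction r with
  | zero => simp [rotheC]
  | succ r ih =>
    rw [Finset.prod_Icc_succ_top (by omega), ih, Finset.sum_range_succ' _ (r + 1)]
    have h1 : ∀ k ∈ Finset.range (r + 1), rotheC q (r + 1) (k + 1) * x ^ (k + 1) *
        y ^ (r + 1 - (k + 1)) = rotheC q r (k + 1) * x ^ (k + 1) * y ^ (r - k) +
          (rotheC q r k * x ^ k * y ^ (r - k)) * (x * q ^ (r + 1)) := by
      intro k _
      rw [rotheC_rec hq, Nat.succ_sub_succ]; ring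
    rw [Finset.sum_congr rfl h1, Finset.sum_add_distrib, ← Finset.sum_mul, mul_add]
    have h2 : (∑ k ∈ Finset.range (r + 1), rotheC q r k * x ^ k * y ^ (r - k)) * y =
        ∑ k ∈ Finset.range (r + 2), rotheC q r k * x ^ k * y ^ (r + 1 - k) := by
      rw [Finset.sum_range_succ _ (r + 1), rotheC_zero_of_lt q (Nat.lt_succ_self r), Finset.sum_mul]
      simp only [zero_mul, add_zero]
      refine Finset.sum_congr rfl fun k hk => ?_
      have : r + 1 - k = (r - k) + 1 := by have := Finset.mem_range.1 hk; omega
      rw [this, pow_succ]; ring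
    rw [h2, Finset.sum_range_succ' _ (r + 1)]
    have h3 : rotheC q r 0 = 1 := by simp [rotheC]
    have h4 : rotheC q (r + 1) 0 = 1 := by simp [rotheC]
    simp only [Nat.succ_sub_succ, h3, h4]
    ring

/-- The coefficient matrix of the q-Abel polynomials. -/
noncomputable def abelMat (q α : ℝ) : ℕ → ℕ → ℝ :=
  extOne (fun m k => qInt q (m + 1) ^ m * newtonMat (-α) (fun i => -(1 / qInt q (i + 1))) m k)

theorem TPr_abel {q α : ℝ} (hq : 0 < q) (hα : α ≤ 0) (N : ℕ) : TPr (N + 1) (abelMat q α) := by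
  apply TPr_extOne
  apply TPr_rowscale _ (fun m => qInt q (m + 1) ^ m) (fun m => (pow_pos (qInt_pos hq m) m).le)
  apply TPr_newton _ (by linarith)
  intro i j hij
  apply neg_le_neg
  exact one_div_le_one_div_of_le (qInt_pos hq i) (qInt_mono hq (by omega))

theorem abelMat_succ {q : ℝ} (hq : 0 < q) (α : ℝ) (m k : ℕ) :
    abelMat q α (m + 1) (k + 1) = rotheC q m k * (-(α * qInt q (m + 1))) ^ (m - k) := by
  show qInt q (m + 1) ^ m * newtonMat (-α) (fun i => -(1 / qInt q (i + 1))) m k = _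
  rcases lt_or_ge m k with h | h
  · rw [rotheC_zero_of_lt q h, newtonMat, newton_prod_zero (fun i => -(1 / qInt q (i + 1))) h]; simp
  · have e : rotheC q m k = qInt q (m + 1) ^ k * ∏ i ∈ Finset.range k,
        (-(1 / qInt q (m + 1)) - -(1 / qInt q (i + 1))) := by
      rw [rotheC, ← Finset.card_range k, ← Finset.prod_const, Finset.card_range,
        ← Finset.prod_mul_distrib]
      refine Finset.prod_congr rfl fun i _ => ?_
      have := (qInt_pos hq m).ne'
      have := (qInt_pos hq i).ne'
      field_simp
      ring
    rw [e, newtonMat, ← neg_mul, mul_pow]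
    have : qInt q (m + 1) ^ m = qInt q (m + 1) ^ k * qInt q (m + 1) ^ (m - k) := by
      rw [← pow_add]; congr 1; omega
    rw [this]; ring

theorem qAbel_eq {q : ℝ} (hq : 0 < q) (α x : ℝ) (n m : ℕ) (h : m ≤ n) :
    qAbel q α m x = ∑ k : Fin (n + 1), abelMat q α m k * x ^ (k : ℕ) := by
  rw [Fin.sum_univ_eq_sum_range (fun k => abelMat q α m k * x ^ k), Finset.sum_range_succ']
  rcases m with _ | m
  · simp [qAbel, abelMat, extOne]
  · have e0 : abelMat q α (m + 1) 0 = 0 := rfl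
    simp only [qAbel, Nat.succ_ne_zero, if_false, Nat.add_sub_cancel, e0, zero_mul, add_zero,
      sub_eq_add_neg]
    rw [rothe hq, Finset.mul_sum]
    rw [← Finset.sum_subset (Finset.range_subset_range.2 h)]
    · refine Finset.sum_congr rfl fun k _ => ?_
      rw [abelMat_succ hq]; ring
    · intro k _ hk
      rw [abelMat_succ hq, rotheC_zero_of_lt q (by simpa using hk)]; simp

theorem qAbel_deriv {q : ℝ} (hq : 0 < q) (α x : ℝ) (n m i : ℕ) (h : m ≤ n) :
    iteratedDeriv i (qAbel q α m) x = (i.factorial : ℝ) *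
      ∑ k : Fin (n + 1), abelMat q α m k * (((k : ℕ).choose i : ℝ) * x ^ ((k : ℕ) - i)) := by
  have e : qAbel q α m = fun x => ∑ k : Fin (n + 1), abelMat q α m k * x ^ (k : ℕ) := by
    funext x; exact qAbel_eq hq α x n m h
  rw [e, iteratedDeriv_fun_sum (fun k _ => by fun_prop), Finset.mul_sum]
  refine Finset.sum_congr rfl fun k _ => ?_
  rw [iteratedDeriv_const_mul_field, iteratedDeriv_pow, Nat.descFactorial_eq_factorial_mul_choose]
  push_cast
  ring

theorem qAbel_wronskian_totallyPos (q α x : ℝ) (hq : 0 < q) (hα : α ≤ 0) (hx : 0 ≤ x)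
    (n : ℕ) :
    IsTotallyPos
      (Matrix.of fun i j : Fin (n + 1) =>
        iteratedDeriv (i : ℕ) (qAbel q α (j : ℕ)) x) := by
  intro p f g hf hg
  rw [← Matrix.det_transpose]
  set A : Matrix (Fin p) (Fin (n + 1)) ℝ := Matrix.of fun i k => abelMat q α (g i) k with hA
  set B : Matrix (Fin (n + 1)) (Fin p) ℝ := Matrix.of fun k j =>
    (((k : ℕ).choose (f j : ℕ) : ℝ) * x ^ ((k : ℕ) - (f j : ℕ))) with hB
  have e : ((Matrix.of fun i j : Fin (n + 1) =>
        iteratedDeriv (i : ℕ) (qAbel q α (j : ℕ)) x).submatrix f g)ᵀ =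
      Matrix.of fun i j => ((f j : ℕ).factorial : ℝ) * (A * B) i j := by
    ext i j
    simp only [Matrix.transpose_apply, Matrix.submatrix_apply, Matrix.of_apply, Matrix.mul_apply,
      hA, hB]
    exact qAbel_deriv hq α x n _ _ (by have := (g i).isLt; omega)
  rw [e, Matrix.det_mul_row (fun j => ((f j : ℕ).factorial : ℝ))]
  apply mul_nonneg (Finset.prod_nonneg fun j _ => by positivity)
  apply det_mul_nonneg_of_minors
  · intro h hh
    exact TPr_abel hq hα n p (fun i => (g i : ℕ)) (fun i => (h i : ℕ)) (fun _ _ w => hg w)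
      (fun _ _ w => hh w) (fun i => (g i).isLt)
  · intro h hh
    exact TPr_pascal x hx (n + 1) p (fun i => (h i : ℕ)) (fun i => (f i : ℕ)) (fun _ _ w => hh w)
      (fun _ _ w => hf w) (fun i => (h i).isLt)
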